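/- Let N ≥ 1 and let p be a probability mass function on ZMod N that is infinitely divisible, i.e., for every n ≥ 1 there exist a pmf q_n on ZMod N and a_n ∈ ZMod N such that δ_{a_n} * q_n^{*n} = p. Then there exist a ∈ ZMod N, a positive divisor M of N, a real λ ≥ 0, and a pmf q on ZMod N such that p = δ_a * u_M * π, where u_M is the uniform distribution on the subgroup of multiples of M in ZMod N (u_M(k) = M/N if M divides k, else 0), and π is the compound Poisson pmf π(z) = ∑_{l=0}^{∞} e^{−λ} (λ^l / l!) · q^{*l}(z) with q^{*0} = δ_0. -/

import Mathlib

open Finset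
open scoped Classical

/-- Convolution of two (probability mass) functions on `ZMod N`:
`(p * q)(z) = ∑_{(x,y) : x + y = z} p(x) q(y)`. -/
noncomputable def zconv {N : ℕ} [NeZero N] (p q : ZMod N → ℝ) : ZMod N → ℝ :=
  fun z => ∑ x : ZMod N, ∑ y : ZMod N, if x + y = z then p x * q y else 0

/-- The degenerate pmf at `a ∈ ZMod N`. -/
noncomputable def zdelta {N : ℕ} (a : ZMod N) : ZMod N → ℝ :=
  fun k => if k = a then 1 else 0

/-- `ziter p m` is the `m`-fold convolution `p^{*m}`, with `p^{*0} = δ_0`. -/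
noncomputable def ziter {N : ℕ} [NeZero N] (p : ZMod N → ℝ) : ℕ → ZMod N → ℝ
  | 0 => zdelta 0
  | m + 1 => zconv p (ziter p m)

open Filter Topology

namespace ZMod

variable {N : ℕ} [NeZero N]

/-- The Fourier transform of a real function on `ZMod N`, with the sign convention of
characteristic functions. -/
noncomputable def charFun (f : ZMod N → ℝ) (k : ZMod N) : ℂ :=
  ∑ x, stdAddChar (x * k) * (f x : ℂ)

lemma charFun_injective : Function.Injective (charFun : (ZMod N → ℝ) → ZMod N → ℂ) := by
  intro f g h
  have : dft (fun x => (f x : ℂ)) = dft (fun x => (g x : ℂ)) := by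
    ext k
    have := congrFun h (-k)
    simpa [charFun, dft_apply] using this
  ext x
  exact_mod_cast congrFun (dft.injective this) x

lemma norm_stdAddChar (x : ZMod N) : ‖(stdAddChar x : ℂ)‖ = 1 := by
  rw [stdAddChar_apply, Circle.norm_coe]

lemma charFun_zconv (f g : ZMod N → ℝ) (k : ZMod N) :
    charFun (zconv f g) k = charFun f k * charFun g k := by
  simp only [charFun, zconv, Complex.ofReal_sum, Finset.mul_sum, Finset.sum_mul]
  rw [Finset.sum_comm]
  refine (Finset.sum_congr rfl fun x _ => Finset.sum_comm).trans ?_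
  rw [Finset.sum_comm]
  refine Finset.sum_congr rfl fun y _ => Finset.sum_congr rfl fun x _ => ?_
  rw [Finset.sum_eq_single (x + y)]
  · simp [add_mul, AddChar.map_add_eq_mul]
    ring
  · intro z _ hz
    simp [hz.symm]
  · simp

lemma charFun_zdelta (a k : ZMod N) : charFun (zdelta a) k = stdAddChar (a * k) := by
  simp [charFun, zdelta, apply_ite Complex.ofReal]

lemma charFun_ziter (f : ZMod N → ℝ) (m : ℕ) (k : ZMod N) :
    charFun (ziter f m) k = charFun f k ^ m := by
  induction m with
  | zero => simp [ziter, charFun_zdelta]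
  | succ m ih => rw [ziter, charFun_zconv, ih, pow_succ']

lemma charFun_comp_add (f : ZMod N → ℝ) (c k : ZMod N) :
    charFun (fun x => f (x + c)) k = stdAddChar (-(c * k)) * charFun f k := by
  simp only [charFun, Finset.mul_sum]
  refine Fintype.sum_equiv (Equiv.addRight c) _ _ fun x => ?_
  simp [← mul_assoc, ← AddChar.map_add_eq_mul, add_mul]

lemma stdAddChar_mul_pow_of_dvd (x k : ZMod N) {n : ℕ} (hn : N ∣ n) :
    (stdAddChar (x * k) : ℂ) ^ n = 1 := by
  rw [← AddChar.map_nsmul_eq_pow, nsmul_eq_mul, (natCast_eq_zero_iff n N).2 hn]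
  simp

lemma charFun_uniform {M : ℕ} (hMN : M ∣ N) (k : ZMod N) :
    charFun (fun x : ZMod N =>
      if ∃ j : ZMod N, (M : ZMod N) * j = x then (M : ℝ) / N else 0) k =
      if (M : ZMod N) * k = 0 then 1 else 0 := by
  have hN : (N : ℂ) ≠ 0 := by exact_mod_cast NeZero.ne N
  split_ifs with hk
  · have hcard : (#{x : ZMod N | ∃ j : ZMod N, (M : ZMod N) * j = x} : ℕ) * M = N := by
      have h1 : #{x : ZMod N | ∃ j : ZMod N, (M : ZMod N) * j = x} =
          Nat.card (AddSubgroup.zmultiples (M : ZMod N)) := by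
        rw [← SetLike.coe_sort_coe, Nat.card_coe_set_eq, ← Set.ncard_coe_finset]
        congr 1
        ext x
        simp only [Finset.coe_filter, Finset.mem_univ, true_and, Set.mem_ofPred_eq,
          SetLike.mem_coe, AddSubgroup.mem_zmultiples_iff]
        constructor
        · rintro ⟨j, rfl⟩
          exact ⟨(j.val : ℤ), by simp [mul_comm]⟩
        · rintro ⟨j, rfl⟩
          exact ⟨(j : ZMod N), by simp [mul_comm]⟩
      rw [h1, Nat.card_zmultiples, addOrderOf_coe _ (NeZero.ne N), Nat.gcd_eq_right hMN]
      exact Nat.div_mul_cancel hMN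
    have : ∀ x : ZMod N, (stdAddChar (x * k) : ℂ) *
        (((if ∃ j : ZMod N, (M : ZMod N) * j = x then (M : ℝ) / N else 0 : ℝ)) : ℂ) =
        if ∃ j : ZMod N, (M : ZMod N) * j = x then (M : ℂ) / N else 0 := by
      intro x
      split_ifs with hx
      · obtain ⟨j, rfl⟩ := hx
        rw [mul_right_comm, hk]
        simp
      · simp
    simp only [charFun, this, ← Finset.sum_filter, Finset.sum_const, nsmul_eq_mul]
    rw [← mul_div_assoc, div_eq_one_iff_eq hN]
    exact_mod_cast hcard
  · set f : ZMod N → ℝ := fun x =>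
      if ∃ j : ZMod N, (M : ZMod N) * j = x then (M : ℝ) / N else 0 with hf
    have h1 : (fun x => f (x + M)) = f := by
      ext x
      have : (∃ j : ZMod N, (M : ZMod N) * j = x + M) ↔ ∃ j : ZMod N, (M : ZMod N) * j = x := by
        constructor
        · rintro ⟨j, hj⟩
          exact ⟨j - 1, by rw [mul_sub, hj]; ring⟩
        · rintro ⟨j, hj⟩
          exact ⟨j + 1, by rw [mul_add, hj]; ring⟩
      simp only [hf, this]
    have h2 := charFun_comp_add f M k
    rw [h1] at h2
    have h3 : (stdAddChar (-((M : ZMod N) * k)) : ℂ) ≠ 1 := by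
      rw [← (stdAddChar (N := N)).map_zero_eq_one, injective_stdAddChar.ne_iff]
      simpa using hk
    by_contra h4
    exact h3 (mul_right_cancel₀ h4 (by rw [one_mul]; exact h2.symm))

lemma ziter_nonneg {q : ZMod N → ℝ} (h0 : ∀ x, 0 ≤ q x) (m : ℕ) (z : ZMod N) :
    0 ≤ ziter q m z := by
  induction m generalizing z with
  | zero => simp only [ziter, zdelta]; positivity
  | succ m ih =>
    refine Finset.sum_nonneg fun x _ => Finset.sum_nonneg fun y _ => ?_
    split_ifs
    · exact mul_nonneg (h0 x) (ih y)
    · rfl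

lemma charFun_zero (f : ZMod N → ℝ) : charFun f 0 = ((∑ x, f x : ℝ) : ℂ) := by
  simp [charFun]

lemma ziter_le_one {q : ZMod N → ℝ} (h0 : ∀ x, 0 ≤ q x) (h1 : ∑ x, q x = 1) (m : ℕ)
    (z : ZMod N) : ziter q m z ≤ 1 := by
  have h := charFun_ziter q m 0
  rw [charFun_zero, charFun_zero, h1] at h
  have h2 : ∑ x, ziter q m x = 1 := by
    rw [← Complex.ofReal_inj, h]
    simp
  rw [← h2]
  exact Finset.single_le_sum (fun x _ => ziter_nonneg h0 m x) (Finset.mem_univ z)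

lemma charFun_compoundPoisson {q : ZMod N → ℝ} (h0 : ∀ x, 0 ≤ q x) (h1 : ∑ x, q x = 1)
    {lam : ℝ} (hlam : 0 ≤ lam) (k : ZMod N) :
    charFun (fun z => ∑' l : ℕ,
      Real.exp (-lam) * lam ^ l / (Nat.factorial l) * ziter q l z) k =
      Complex.exp (lam * (charFun q k - 1)) := by
  have hsum : ∀ z, Summable fun l : ℕ =>
      Real.exp (-lam) * lam ^ l / (Nat.factorial l) * ziter q l z := by
    intro z
    refine Summable.of_nonneg_of_le (fun l => ?_) (fun l => ?_)
      ((Real.summable_pow_div_factorial lam).mul_left (Real.exp (-lam)))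
    · have := ziter_nonneg h0 l z
      positivity
    · rw [← mul_div_assoc]
      exact mul_le_of_le_one_right (by positivity) (ziter_le_one h0 h1 l z)
  have h2 : HasSum (fun l : ℕ => ∑ x, (stdAddChar (x * k) : ℂ) *
      ((Real.exp (-lam) * lam ^ l / (Nat.factorial l) * ziter q l x : ℝ) : ℂ))
      (charFun (fun z => ∑' l : ℕ,
        Real.exp (-lam) * lam ^ l / (Nat.factorial l) * ziter q l z) k) :=
    hasSum_sum fun x _ => (Complex.hasSum_ofReal.2 (hsum x).hasSum).mul_left _
  have h3 := (NormedSpace.expSeries_div_hasSum_exp (lam * charFun q k)).mul_left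
    (Complex.exp (-lam))
  rw [← Complex.exp_eq_exp_ℂ, ← Complex.exp_add] at h3
  refine (h2.unique ?_).trans (congrArg Complex.exp (by ring : -(lam : ℂ) + lam * charFun q k = _))
  convert! h3 using 2 with l
  rw [mul_pow, ← charFun_ziter, charFun, Finset.mul_sum, Finset.sum_div, Finset.mul_sum]
  refine Finset.sum_congr rfl fun x _ => ?_
  push_cast
  ring

lemma exists_forall_mem_iff_mul_eq_zero (S : AddSubgroup (ZMod N)) :
    ∃ M : ℕ, 0 < M ∧ M ∣ N ∧ ∀ k, k ∈ S ↔ (M : ZMod N) * k = 0 := by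
  refine ⟨Nat.card S, Nat.card_pos, ?_, ?_⟩
  · simpa using S.card_addSubgroup_dvd_card
  · have hsub : ∀ k ∈ S, ((Nat.card S : ℕ) : ZMod N) * k = 0 := by
      intro k hk
      have := congrArg Subtype.val (card_nsmul_eq_zero' (x := (⟨k, hk⟩ : S)))
      rwa [AddSubgroup.coe_nsmul, nsmul_eq_mul] at this
    have hle := IsAddCyclic.card_nsmul_eq_zero_le (α := ZMod N) (n := Nat.card S) Nat.card_pos
    have hS : (Finset.univ.filter fun k => k ∈ S) =
        Finset.univ.filter fun k : ZMod N => Nat.card S • k = 0 := by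
      refine Finset.eq_of_subset_of_card_le (fun k hk => ?_) ?_
      · simpa using hsub k (by simpa using hk)
      · refine (le_of_eq ?_).trans (hle.trans (le_of_eq ?_))
        · congr
        · rw [← SetLike.coe_sort_coe, Nat.card_coe_set_eq, ← Set.ncard_coe_finset]
          congr 1
          ext
          simp
    intro k
    simpa using Finset.ext_iff.1 hS k

lemma charFun_eq_one_add {f : ZMod N → ℝ} (h1 : ∑ x, f x = 1) (k : ZMod N) :
    charFun f k = 1 + ∑ x, (f x : ℂ) * (stdAddChar (x * k) - 1) := by
  have : (∑ x, (f x : ℂ)) = 1 := by exact_mod_cast h1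
  simp only [mul_sub, Finset.sum_sub_distrib, mul_one, this, charFun, add_sub_cancel]
  exact Finset.sum_congr rfl fun x _ => mul_comm _ _

lemma re_stdAddChar_le_one (x : ZMod N) : (stdAddChar x : ℂ).re ≤ 1 :=
  (Complex.re_le_norm _).trans (norm_stdAddChar x).le

lemma re_sq_add_im_sq_stdAddChar (x : ZMod N) :
    (stdAddChar x : ℂ).re ^ 2 + (stdAddChar x : ℂ).im ^ 2 = 1 := by
  rw [sq, sq, ← Complex.normSq_apply, Complex.normSq_eq_norm_sq, norm_stdAddChar, one_pow]

lemma norm_charFun_sq_le {f : ZMod N → ℝ} (h0 : ∀ x, 0 ≤ f x) (h1 : ∑ x, f x = 1) {k : ZMod N}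
    (hk : ∑ x, (if (stdAddChar (x * k) : ℂ) = 1 then 0 else f x) ≤ 1 / 2) :
    ‖charFun f k‖ ^ 2 ≤ 1 - ∑ x, f x * (1 - (stdAddChar (x * k) : ℂ).re) := by
  set w : ZMod N → ℂ := fun x => stdAddChar (x * k) with hw
  set s : ℝ := ∑ x, (if w x = 1 then 0 else f x) with hs
  set A : ℝ := ∑ x, f x * (1 - (w x).re) with hA
  set B : ℝ := ∑ x, f x * (w x).im with hB
  have hA0 : 0 ≤ A :=
    Finset.sum_nonneg fun x _ => mul_nonneg (h0 x) (sub_nonneg.2 (re_stdAddChar_le_one _))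
  have hre : (charFun f k).re = 1 - A := by
    simp [charFun, hA, hw, mul_sub, h1, mul_comm]
  have him : (charFun f k).im = B := by
    simp [charFun, hB, hw, mul_comm]
  have hAs : A ^ 2 ≤ s * ∑ x, f x * (1 - (w x).re) ^ 2 := by
    refine Finset.sum_sq_le_sum_mul_sum_of_sq_le_mul _ (fun x _ => ?_) (fun x _ => ?_)
      (fun x _ => ?_)
    · split_ifs
      exacts [le_rfl, h0 x]
    · exact mul_nonneg (h0 x) (sq_nonneg _)
    · split_ifs with h
      · simp [h]
      · exact le_of_eq (by ring)
  have hBs : B ^ 2 ≤ s * ∑ x, f x * (w x).im ^ 2 := by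
    refine Finset.sum_sq_le_sum_mul_sum_of_sq_le_mul _ (fun x _ => ?_) (fun x _ => ?_)
      (fun x _ => ?_)
    · split_ifs
      exacts [le_rfl, h0 x]
    · exact mul_nonneg (h0 x) (sq_nonneg _)
    · split_ifs with h
      · simp [h]
      · exact le_of_eq (by ring)
  have hsum : ∑ x, f x * (1 - (w x).re) ^ 2 + ∑ x, f x * (w x).im ^ 2 = 2 * A := by
    rw [hA, Finset.mul_sum, ← Finset.sum_add_distrib]
    refine Finset.sum_congr rfl fun x _ => ?_
    linear_combination f x * re_sq_add_im_sq_stdAddChar (x * k)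
  rw [← Complex.normSq_eq_norm_sq, Complex.normSq_apply, hre, him]
  nlinarith

lemma stdAddChar_eq_one_of_norm_charFun_eq_one {f : ZMod N → ℝ} (h0 : ∀ x, 0 ≤ f x)
    (h1 : ∑ x, f x = 1) (hf0 : f 0 ≠ 0) {k : ZMod N} (hk : ‖charFun f k‖ = 1) {x : ZMod N}
    (hx : f x ≠ 0) : (stdAddChar (x * k) : ℂ) = 1 := by
  set u := charFun f k with hu
  have huu : (starRingEnd ℂ) u * u = 1 := by
    rw [mul_comm, Complex.mul_conj, Complex.normSq_eq_norm_sq, hk]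
    simp
  have hnorm : ∀ y, ‖(starRingEnd ℂ) u * stdAddChar (y * k)‖ = 1 := by
    intro y
    rw [norm_mul, RCLike.norm_conj, hk, norm_stdAddChar, one_mul]
  have hle : ∀ y, ((starRingEnd ℂ) u * stdAddChar (y * k)).re ≤ 1 := fun y =>
    (Complex.re_le_norm _).trans (hnorm y).le
  have hsum : ∑ y, f y * (1 - ((starRingEnd ℂ) u * stdAddChar (y * k)).re) = 0 := by
    have h2 : ∑ y, f y * ((starRingEnd ℂ) u * stdAddChar (y * k)).re = 1 := by
      have := congrArg Complex.re huu
      rw [hu, charFun, Finset.mul_sum, Complex.re_sum, Complex.one_re, ← charFun, ← hu] at this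
      rw [← this]
      refine Finset.sum_congr rfl fun y _ => ?_
      rw [← mul_assoc, Complex.re_mul_ofReal, mul_comm]
    simp only [mul_sub, mul_one, Finset.sum_sub_distrib, h1, h2, sub_self]
  have key : ∀ y, f y ≠ 0 → (stdAddChar (y * k) : ℂ) = u := by
    intro y hy
    have h3 := (Finset.sum_eq_zero_iff_of_nonneg fun y _ =>
      mul_nonneg (h0 y) (sub_nonneg.2 (hle y))).1 hsum y (Finset.mem_univ y)
    have h4 : ((starRingEnd ℂ) u * stdAddChar (y * k)).re = 1 := by
      have := (mul_eq_zero.1 h3).resolve_left hy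
      linarith
    have h5 : (starRingEnd ℂ) u * stdAddChar (y * k) = 1 := by
      have h6 := Complex.re_eq_norm.1 (h4.trans (hnorm y).symm)
      rw [Complex.nonneg_iff] at h6
      exact Complex.ext h4 h6.2.symm
    have : (starRingEnd ℂ) u ≠ 0 := left_ne_zero_of_mul_eq_one huu
    exact mul_left_cancel₀ this (h5.trans huu.symm)
  rw [key x hx, ← key 0 hf0]
  simp

lemma _root_.Complex.tendsto_one_add_pow_exp_of_le_atTop {l : Filter ℕ} (hl : l ≤ atTop)
    {g : ℕ → ℂ} {t : ℂ} (hg : Tendsto (fun n : ℕ => n * g n) l (𝓝 t)) :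
    Tendsto (fun n => (1 + g n) ^ n) l (𝓝 (Complex.exp t)) := by
  have hn : ∀ᶠ n : ℕ in l, n ≠ 0 := hl (eventually_ne_atTop 0)
  have hg0 : Tendsto g l (𝓝 0) := by
    have h := (tendsto_inv_atTop_nhds_zero_nat (𝕜 := ℂ)).mono_left hl |>.mul hg
    rw [zero_mul] at h
    refine h.congr' ?_
    filter_upwards [hn] with n hn
    field_simp
  have hd : HasDerivAt (fun z : ℂ => Complex.log (1 + z)) 1 0 := by
    have := ((hasDerivAt_id (0 : ℂ)).const_add 1).clog (by simp)
    simpa using this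
  have hs : Tendsto (fun n => dslope (fun z : ℂ => Complex.log (1 + z)) 0 (g n)) l (𝓝 1) := by
    have hc := continuousAt_dslope_same.2 hd.differentiableAt
    have := hc.tendsto.comp hg0
    rwa [dslope_same, hd.deriv] at this
  have hlog : Tendsto (fun n : ℕ => n * Complex.log (1 + g n)) l (𝓝 t) := by
    have := hg.mul hs
    rw [mul_one] at this
    refine this.congr fun n => ?_
    have h := sub_smul_dslope (fun z : ℂ => Complex.log (1 + z)) 0 (g n)
    simp only [sub_zero, add_zero, Complex.log_one, smul_eq_mul] at h
    rw [mul_assoc, h]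
  refine ((Complex.continuous_exp.tendsto t).comp hlog).congr' ?_
  filter_upwards [hg0.eventually_ne (show (0 : ℂ) ≠ -1 by simp)] with n hn
  have : 1 + g n ≠ 0 := fun h => hn (by linear_combination h)
  rw [Function.comp_apply, Complex.exp_nat_mul, Complex.exp_log this]

lemma _root_.Ultrafilter.exists_tendsto_of_mem_Icc {ι : Type*} (U : Ultrafilter ι) {f : ι → ℝ}
    {a b : ℝ} (h : ∀ᶠ i in U, f i ∈ Set.Icc a b) :
    ∃ c ∈ Set.Icc a b, Tendsto f U (𝓝 c) :=
  isCompact_Icc.ultrafilter_le_nhds (U.map f) (le_principal_iff.2 h)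

/-- If the `n`-th powers of characteristic functions of pmfs `r n` stay away from zero on `S`,
and the `r n` concentrate on the annihilator of `S`, then these powers converge along an
ultrafilter to a characteristic function of compound Poisson type. -/
lemma exists_tendsto_charFun_pow {U : Ultrafilter ℕ} (hU : (U : Filter ℕ) ≤ atTop)
    {r : ℕ → ZMod N → ℝ} (h0 : ∀ n x, 0 ≤ r n x) (h1 : ∀ n, ∑ x, r n x = 1)
    {S : Set (ZMod N)} {c : ZMod N → ℝ} (hc : ∀ k ∈ S, 0 < c k)
    (hcr : ∀ k ∈ S, ∀ᶠ n in U, c k ≤ ‖charFun (r n) k‖ ^ n)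
    (hr : ∀ k ∈ S, ∀ x : ZMod N, (stdAddChar (x * k) : ℂ) ≠ 1 →
      Tendsto (fun n => r n x) U (𝓝 0)) :
    ∃ ν : ZMod N → ℝ, (∀ x, 0 ≤ ν x) ∧ ∀ k ∈ S,
      Tendsto (fun n => charFun (r n) k ^ n) U
        (𝓝 (Complex.exp (∑ x, (ν x : ℂ) * (stdAddChar (x * k) - 1)))) := by
  have hbound : ∀ k ∈ S, ∀ᶠ n in U,
      n * ∑ x, r n x * (1 - (stdAddChar (x * k) : ℂ).re) ≤ -(2 * Real.log (c k)) := by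
    intro k hk
    have hs : Tendsto (fun n => ∑ x, (if (stdAddChar (x * k) : ℂ) = 1 then 0 else r n x)) U
        (𝓝 (∑ x : ZMod N, 0)) := by
      refine tendsto_finsetSum _ fun x _ => ?_
      split_ifs with h
      exacts [tendsto_const_nhds, hr k hk x h]
    rw [Finset.sum_const_zero] at hs
    filter_upwards [hs.eventually_le_const (show (0 : ℝ) < 1 / 2 by norm_num), hcr k hk]
      with n hn hcn
    have h2 := norm_charFun_sq_le (h0 n) (h1 n) hn
    set A := ∑ x, r n x * (1 - (stdAddChar (x * k) : ℂ).re)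
    have h3 : c k ^ 2 ≤ Real.exp (-(n * A)) :=
      calc c k ^ 2 ≤ (‖charFun (r n) k‖ ^ n) ^ 2 := by gcongr; exact (hc k hk).le
        _ = (‖charFun (r n) k‖ ^ 2) ^ n := pow_right_comm ..
        _ ≤ (Real.exp (-A)) ^ n := by
          gcongr
          linarith [Real.add_one_le_exp (-A)]
        _ = Real.exp (-(n * A)) := by rw [← Real.exp_nat_mul, mul_neg]
    have h4 := Real.log_le_log (pow_pos (hc k hk) 2) h3
    rw [Real.log_exp, Real.log_pow] at h4
    push_cast at h4
    linarith
  have hν : ∀ x : ZMod N, ∃ y : ℝ, 0 ≤ y ∧ ∀ k ∈ S, (stdAddChar (x * k) : ℂ) ≠ 1 →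
      Tendsto (fun n : ℕ => n * r n x) U (𝓝 y) := by
    intro x
    by_cases hx : ∃ k ∈ S, (stdAddChar (x * k) : ℂ) ≠ 1
    · obtain ⟨k, hk, hxk⟩ := hx
      have hpos : 0 < 1 - (stdAddChar (x * k) : ℂ).re := by
        refine sub_pos.2 (lt_of_le_of_ne (re_stdAddChar_le_one _) fun h => hxk ?_)
        have := re_sq_add_im_sq_stdAddChar (x * k)
        refine Complex.ext h ?_
        rw [h] at this
        simpa using this
      obtain ⟨y, hy, hlim⟩ := U.exists_tendsto_of_mem_Icc (f := fun n : ℕ => n * r n x) (a := 0)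
        (b := -(2 * Real.log (c k)) / (1 - (stdAddChar (x * k) : ℂ).re)) (by
          filter_upwards [hbound k hk] with n hn
          refine ⟨mul_nonneg n.cast_nonneg (h0 n x), (le_div_iff₀ hpos).2 (le_trans ?_ hn)⟩
          rw [mul_assoc]
          gcongr
          exact Finset.single_le_sum
            (f := fun x => r n x * (1 - (stdAddChar (x * k) : ℂ).re))
            (fun x _ => mul_nonneg (h0 n x) (sub_nonneg.2 (re_stdAddChar_le_one _)))
            (Finset.mem_univ x))
      exact ⟨y, hy.1, fun _ _ _ => hlim⟩
    · push Not at hx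
      exact ⟨0, le_rfl, fun k hk h => absurd (hx k hk) h⟩
  choose ν hν0 hν using hν
  refine ⟨ν, hν0, fun k hk => ?_⟩
  simp only [fun n => charFun_eq_one_add (h1 n) k]
  refine Complex.tendsto_one_add_pow_exp_of_le_atTop hU ?_
  simp only [Finset.mul_sum, ← mul_assoc]
  refine tendsto_finsetSum _ fun x _ => ?_
  by_cases h : (stdAddChar (x * k) : ℂ) = 1
  · simp [h]
  · refine Tendsto.mul_const _ ?_
    exact_mod_cast (Complex.continuous_ofReal.tendsto _).comp (hν x k hk h)

end ZMod

open ZMod in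
/-- Every infinitely divisible pmf `p` on `ZMod N` (for every `n ≥ 1` there are a
pmf `q_n` and a shift `a_n` with `δ_{a_n} * q_n^{*n} = p`) is the convolution of a
shift `δ_a`, the uniform distribution `u_M` on the subgroup of multiples of a
positive divisor `M` of `N`, and a compound Poisson distribution
`π(z) = ∑_{l=0}^∞ e^{−λ} (λ^l / l!) q^{*l}(z)`. -/
theorem infinitely_divisible_repr (N : ℕ) [NeZero N] (p : ZMod N → ℝ)
    (hp0 : ∀ k, 0 ≤ p k) (hp1 : ∑ k : ZMod N, p k = 1)
    (hdiv : ∀ n : ℕ, 1 ≤ n → ∃ (qn : ZMod N → ℝ) (an : ZMod N),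
      (∀ k, 0 ≤ qn k) ∧ (∑ k : ZMod N, qn k = 1) ∧
        zconv (zdelta an) (ziter qn n) = p) :
    ∃ (a : ZMod N) (M : ℕ) (lam : ℝ) (q : ZMod N → ℝ),
      0 < M ∧ M ∣ N ∧ 0 ≤ lam ∧ (∀ k, 0 ≤ q k) ∧ (∑ k : ZMod N, q k = 1) ∧
      p = zconv (zdelta a)
            (zconv
              (fun k => if ∃ j : ZMod N, (M : ZMod N) * j = k then (M : ℝ) / N else 0)
              (fun z => ∑' l : ℕ,
                Real.exp (-lam) * lam ^ l / (Nat.factorial l) * ziter q l z)) := by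
  have hdiv' : ∀ n : ℕ, ∃ (qn : ZMod N → ℝ) (an : ZMod N),
      (∀ k, 0 ≤ qn k) ∧ (∑ k : ZMod N, qn k = 1) ∧
        (1 ≤ n → zconv (zdelta an) (ziter qn n) = p) := by
    intro n
    rcases Nat.lt_or_ge n 1 with hn | hn
    · exact ⟨p, 0, hp0, hp1, fun h => absurd h hn.not_ge⟩
    · obtain ⟨q, a, h⟩ := hdiv n hn
      exact ⟨q, a, h.1, h.2.1, fun _ => h.2.2⟩
  choose q a hq0 hq1 hqp using hdiv'
  obtain ⟨U, hU, hUN⟩ : ∃ U : Ultrafilter ℕ, (U : Filter ℕ) ≤ atTop ∧ ∀ᶠ n in U, N ∣ n := by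
    refine ⟨(hyperfilter ℕ).map fun n => N * n, ?_, ?_⟩
    · have : Tendsto (fun n => N * n) atTop atTop :=
        tendsto_id.const_mul_atTop' (NeZero.pos N)
      exact this.mono_left Nat.hyperfilter_le_atTop
    · exact eventually_map.2 (Eventually.of_forall fun n => dvd_mul_right N n)
  have hU1 : ∀ᶠ n in U, 1 ≤ n := hU (eventually_ge_atTop 1)
  obtain ⟨a₀, ha₀⟩ : ∃ a₀, ∀ᶠ n in U, a n = a₀ := by
    obtain ⟨a₀, h⟩ := (U.map a).eq_pure_of_finite
    refine ⟨a₀, ?_⟩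
    have : ({a₀} : Set (ZMod N)) ∈ U.map a := by rw [h]; exact Set.mem_singleton a₀
    exact this
  have hlim : ∀ x, ∃ y ∈ Set.Icc (0 : ℝ) 1, Tendsto (fun n => q n x) U (𝓝 y) := fun x =>
    U.exists_tendsto_of_mem_Icc (Eventually.of_forall fun n =>
      ⟨hq0 n x, hq1 n ▸ Finset.single_le_sum (fun y _ => hq0 n y) (Finset.mem_univ x)⟩)
  choose L hL hqL using hlim
  have hL1 : ∑ x, L x = 1 := by
    refine tendsto_nhds_unique (tendsto_finsetSum Finset.univ fun x _ => hqL x) ?_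
    simp only [hq1, tendsto_const_nhds]
  obtain ⟨x₀, hx₀⟩ : ∃ x₀, L x₀ ≠ 0 := by
    by_contra! h
    simp [h] at hL1
  have hsum_add : ∀ f : ZMod N → ℝ, ∑ x, f (x + x₀) = ∑ x, f x := fun f =>
    Equiv.sum_comp (Equiv.addRight x₀) f
  set r : ℕ → ZMod N → ℝ := fun n x => q n (x + x₀) with hr
  set R : ZMod N → ℝ := fun x => L (x + x₀) with hR
  have hr0 : ∀ n x, 0 ≤ r n x := fun n x => hq0 n _
  have hr1 : ∀ n, ∑ x, r n x = 1 := fun n => (hsum_add _).trans (hq1 n)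
  have hR0 : ∀ x, 0 ≤ R x := fun x => (hL _).1
  have hR1 : ∑ x, R x = 1 := (hsum_add _).trans hL1
  have hrR : ∀ k, Tendsto (fun n => charFun (r n) k) U (𝓝 (charFun R k)) := fun k =>
    tendsto_finsetSum _ fun x _ =>
      ((Complex.continuous_ofReal.tendsto _).comp (hqL (x + x₀))).const_mul _
  have hpr : ∀ᶠ n in U, ∀ k, charFun p k = stdAddChar (a₀ * k) * charFun (r n) k ^ n := by
    filter_upwards [hU1, hUN, ha₀] with n hn hnN hna k
    rw [← hqp n hn, charFun_zconv, charFun_zdelta, charFun_ziter, hna, hr, charFun_comp_add,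
      mul_pow, ← neg_mul, stdAddChar_mul_pow_of_dvd _ _ hnN, one_mul]
  have hnorm : ∀ᶠ n in U, ∀ k, ‖charFun (r n) k‖ ^ n = ‖charFun p k‖ := by
    filter_upwards [hpr] with n hn k
    rw [hn k, norm_mul, norm_stdAddChar, one_mul, norm_pow]
  have hS : ∀ k, charFun p k ≠ 0 ↔ ∀ x, R x ≠ 0 → (stdAddChar (x * k) : ℂ) = 1 := by
    intro k
    constructor
    · intro hk x hx
      refine stdAddChar_eq_one_of_norm_charFun_eq_one hR0 hR1 (by simpa [hR] using hx₀) ?_ hx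
      refine tendsto_nhds_unique (hrR k).norm ?_
      have h1 : Tendsto (fun n : ℕ => Real.exp (Real.log ‖charFun p k‖ / n)) U (𝓝 1) := by
        have := (tendsto_const_div_atTop_nhds_zero_nat (Real.log ‖charFun p k‖)).mono_left hU
        simpa [Function.comp_def] using (Real.continuous_exp.tendsto 0).comp this
      refine h1.congr' ?_
      filter_upwards [hnorm, hU1] with n hn hn1
      have hn0 : (n : ℝ) ≠ 0 := by positivity
      have hpos : 0 < ‖charFun (r n) k‖ := by
        refine norm_pos_iff.2 fun h => hk ?_
        rw [← norm_eq_zero, ← hn k, h, norm_zero, zero_pow (by lia)]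
      rw [← hn k, Real.log_pow, mul_div_cancel_left₀ _ hn0, Real.exp_log hpos]
    · intro h hk
      have h1 : charFun R k = 1 := by
        rw [charFun_eq_one_add hR1, add_eq_left]
        refine Finset.sum_eq_zero fun x _ => ?_
        by_cases hx : R x = 0
        · simp [hx]
        · simp [h x hx]
      have h2 := hrR k
      rw [h1] at h2
      obtain ⟨n, hn, hn', hn1⟩ :=
        (hnorm.and ((h2.eventually_ne one_ne_zero).and hU1)).exists
      have := hn k
      rw [hk, norm_zero] at this
      exact hn' (norm_eq_zero.1 (eq_zero_of_pow_eq_zero this))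
  obtain ⟨M, hM0, hMN, hM⟩ := exists_forall_mem_iff_mul_eq_zero (N := N)
    { carrier := {k | ∀ x, R x ≠ 0 → (stdAddChar (x * k) : ℂ) = 1}
      zero_mem' := by simp
      add_mem' := fun {k l} hk hl x hx => by
        rw [mul_add, AddChar.map_add_eq_mul, hk x hx, hl x hx, one_mul]
      neg_mem' := fun {k} hk x hx => by
        rw [mul_neg, AddChar.map_neg_eq_inv, hk x hx, inv_one] }
  replace hM : ∀ k, charFun p k ≠ 0 ↔ (M : ZMod N) * k = 0 := fun k => (hS k).trans (hM k)
  obtain ⟨ν, hν0, hν⟩ := exists_tendsto_charFun_pow hU hr0 hr1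
    (S := {k | charFun p k ≠ 0}) (c := fun k => ‖charFun p k‖)
    (fun k hk => norm_pos_iff.2 hk) (fun k _ => hnorm.mono fun n hn => (hn k).ge)
    (fun k hk x hx => by
      have : R x = 0 := by
        by_contra h
        exact hx ((hS k).1 hk x h)
      exact this ▸ hqL (x + x₀))
  obtain ⟨lam, μ, hlam, hμ0, hμ1, hμν⟩ : ∃ (lam : ℝ) (μ : ZMod N → ℝ), 0 ≤ lam ∧
      (∀ x, 0 ≤ μ x) ∧ ∑ x, μ x = 1 ∧ ∀ x, lam * μ x = ν x := by
    rcases (Finset.sum_nonneg fun x _ => hν0 x : 0 ≤ ∑ x, ν x).eq_or_lt' with h | h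
    · refine ⟨0, p, le_rfl, hp0, hp1, fun x => ?_⟩
      rw [zero_mul, (Finset.sum_eq_zero_iff_of_nonneg fun x _ => hν0 x).1 h x (Finset.mem_univ x)]
    · refine ⟨∑ x, ν x, fun x => ν x / ∑ x, ν x, h.le, fun x => div_nonneg (hν0 x) h.le, ?_,
        fun x => mul_div_cancel₀ _ h.ne'⟩
      rw [← Finset.sum_div, div_self h.ne']
  refine ⟨a₀, M, lam, μ, hM0, hMN, hlam, hμ0, hμ1, charFun_injective (funext fun k => ?_)⟩
  rw [charFun_zconv, charFun_zconv, charFun_zdelta, charFun_uniform hMN,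
    charFun_compoundPoisson hμ0 hμ1 hlam]
  split_ifs with hk
  · have hk' := (hM k).2 hk
    have h1 := (hν k hk').const_mul (stdAddChar (a₀ * k) : ℂ)
    have h2 : Tendsto (fun n => (stdAddChar (a₀ * k) : ℂ) * charFun (r n) k ^ n) U
        (𝓝 (charFun p k)) :=
      tendsto_const_nhds.congr' (hpr.mono fun n hn => hn k)
    rw [tendsto_nhds_unique h2 h1, one_mul, charFun_eq_one_add hμ1, add_sub_cancel_left,
      Finset.mul_sum]
    simp only [← hμν, Complex.ofReal_mul, mul_assoc]
  · rw [zero_mul, mul_zero]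
    by_contra h
    exact hk ((hM k).1 h)
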